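/- Let π be a pairing of {1,...,m} (m even) regarded as a fixed-point-free involution in S_m, and γ = (1,2,...,m). Then #cycles(γπ) = m/2 + 1 if and only if π is non-crossing. -/

import Mathlib

/-- The number of cycles of a permutation of `Fin m` (fixed points counted as
cycles of length one). -/
def cycleCount {m : ℕ} (σ : Equiv.Perm (Fin m)) : ℕ :=
  Multiset.card σ.cycleType + (Finset.univ.filter fun x => σ x = x).card

/-- The number of cycles of a permutation is the number of classes of `SameCycle`. -/
theorem cycleCount_eq_card_quotient {m : ℕ} (σ : Equiv.Perm (Fin m)) :
    cycleCount σ = Nat.card (Quotient (Equiv.Perm.SameCycle.setoid σ)) := by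
  have hex : ∀ c : σ.cycleFactorsFinset, ∃ a, σ a ≠ a ∧ c.1 = σ.cycleOf a := by
    intro c
    obtain ⟨a, ha⟩ := (Equiv.Perm.mem_cycleFactorsFinset_iff.1 c.2).1.nonempty_support
    have hc := Equiv.Perm.cycle_is_cycleOf ha c.2
    exact ⟨a, Equiv.Perm.cycleOf_mem_cycleFactorsFinset_iff.1 (hc ▸ c.2) |>
      Equiv.Perm.mem_support.1, hc⟩
  choose a ha hca using hex
  let f : σ.cycleFactorsFinset ⊕ (Finset.univ.filter fun x => σ x = x) →
      Quotient (Equiv.Perm.SameCycle.setoid σ) :=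
    Sum.elim (fun c => Quotient.mk _ (a c)) (fun x => Quotient.mk _ x.1)
  have hf : Function.Bijective f := by
    constructor
    · rintro (c | ⟨x, hx⟩) (d | ⟨y, hy⟩) h
      · have h : σ.SameCycle (a c) (a d) := Quotient.exact h
        congr 1
        ext1
        rw [hca c, hca d, h.cycleOf_eq]
      · have h : σ.SameCycle (a c) y := Quotient.exact h
        exact absurd (h.apply_eq_self_iff.2 (by simpa using hy)) (ha c)
      · have h : σ.SameCycle x (a d) := Quotient.exact h
        exact absurd (h.apply_eq_self_iff.1 (by simpa using hx)) (ha d)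
      · have h : σ.SameCycle x y := Quotient.exact h
        have hx : σ x = x := by simpa using hx
        have := h.eq_of_left hx
        subst this
        rfl
    · intro q
      induction q using Quotient.inductionOn with
      | h x =>
        by_cases hx : σ x = x
        · exact ⟨Sum.inr ⟨x, by simpa using hx⟩, rfl⟩
        · have hm : σ.cycleOf x ∈ σ.cycleFactorsFinset :=
            Equiv.Perm.cycleOf_mem_cycleFactorsFinset_iff.2 (Equiv.Perm.mem_support.2 hx)
          refine ⟨Sum.inl ⟨_, hm⟩, Quotient.sound ?_⟩
          exact ((Equiv.Perm.sameCycle_iff_cycleOf_eq_of_mem_support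
            (Equiv.Perm.mem_support.2 hx) (Equiv.Perm.mem_support.2 (ha _))).2
              (hca ⟨_, hm⟩)).symm
  rw [← Nat.card_congr (Equiv.ofBijective f hf), Nat.card_sum, cycleCount,
    Equiv.Perm.cycleType_def, Multiset.card_map, Finset.card_val, Nat.card_eq_fintype_card,
    Nat.card_eq_fintype_card, Fintype.card_coe, Fintype.card_coe]

/-- If identifying `x` with `p x` for `x ∈ S` makes the quotient `q : α → V` trivial, then
`V` has at most `#S + 1` elements. -/
theorem card_le_card_add_one_of_connecting {α V : Type*} [Finite V] [Nonempty V]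
    (q : α → V) (hq : Function.Surjective q) (p : α → α) (S : Finset α)
    (H : ∀ r : α → α → Prop, Equivalence r → (∀ x y, q x = q y → r x y) →
      (∀ x ∈ S, r x (p x)) → ∀ x y, r x y) :
    Nat.card V ≤ S.card + 1 := by
  set E : Set (Sym2 V) := (fun i => s(q i, q (p i))) '' S with hE
  let G := SimpleGraph.fromEdgeSet E
  have hconn : G.Connected := by
    have := H (fun x y => G.Reachable (q x) (q y))
      ⟨fun x => .refl _, fun h => h.symm, fun h h' => h.trans h'⟩
      (fun x y h => by rw [h]) (fun x hx => by
        by_cases h : q x = q (p x)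
        · rw [← h]
        · refine SimpleGraph.Adj.reachable ?_
          rw [SimpleGraph.fromEdgeSet_adj]
          exact ⟨⟨x, hx, rfl⟩, h⟩)
    refine SimpleGraph.connected_iff _ |>.2 ⟨fun u v => ?_, inferInstance⟩
    obtain ⟨x, rfl⟩ := hq u
    obtain ⟨y, rfl⟩ := hq v
    exact this x y
  refine hconn.card_vert_le_card_edgeSet_add_one.trans (Nat.add_le_add_right ?_ 1)
  have hsub : G.edgeSet ⊆ E := by
    rw [SimpleGraph.edgeSet_fromEdgeSet]
    exact Set.sdiff_subset
  have hfin : E.Finite := S.finite_toSet.image _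
  calc Nat.card G.edgeSet ≤ E.ncard := Set.ncard_le_ncard hsub hfin
    _ ≤ (S : Set α).ncard := Set.ncard_image_le S.finite_toSet
    _ = S.card := Set.ncard_coe_finset S

theorem val_finRotate {m : ℕ} (x : Fin m) :
    (finRotate m x : ℕ) = if (x : ℕ) + 1 = m then 0 else (x : ℕ) + 1 := by
  obtain ⟨n, rfl⟩ : ∃ n, m = n + 1 := ⟨m - 1, by have := x.2; omega⟩
  rw [coe_finRotate]
  simp [Fin.ext_iff]

/-- An equivalence relation relating each point of `[a, b)` to its successor relates
`a` and `b`. -/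
theorem Equivalence.rel_of_finRotate {m : ℕ} {r : Fin m → Fin m → Prop} (hr : Equivalence r)
    {a b : Fin m} (hab : a ≤ b) (h : ∀ x, a ≤ x → x < b → r x (finRotate m x)) : r a b := by
  have key : ∀ d : ℕ, ∀ c : Fin m, (c : ℕ) = a + d → c ≤ b → r a c := by
    intro d
    induction d with
    | zero =>
      intro c hc _
      rw [show c = a from Fin.ext hc]
      exact hr.refl a
    | succ d ih =>
      intro c hc hcb
      have hcm := c.2
      let e : Fin m := ⟨a + d, by omega⟩
      have hec : finRotate m e = c := by
        ext
        rw [val_finRotate, if_neg (by simp only [e]; omega), hc]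
        simp only [e]; omega
      have heb : e < b := by
        rw [Fin.lt_def]; rw [Fin.le_def] at hcb; simp only [e]; omega
      refine hr.trans (ih e rfl heb.le) ?_
      have := h e (Fin.le_def.2 (by simp only [e]; omega)) heb
      rwa [hec] at this
  exact key (b - a) b (by rw [Fin.le_def] at hab; omega) le_rfl

/-- A fixed-point-free involution of `Fin m` has `m / 2` pairs. -/
theorem card_filter_lt_apply {m : ℕ} (π : Equiv.Perm (Fin m)) (hπ : ∀ x, π (π x) = x)
    (hfix : ∀ i, π i ≠ i) : (Finset.univ.filter fun i => i < π i).card = m / 2 := by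
  have h1 : (Finset.univ.filter fun i => i < π i).card =
      (Finset.univ.filter fun i => ¬ i < π i).card := by
    refine Finset.card_bij (fun i _ => π i) ?_ (fun _ _ _ _ h => π.injective h) ?_
    · intro i hi
      simp only [Finset.mem_filter, Finset.mem_univ, true_and] at hi ⊢
      rw [hπ]
      exact hi.not_gt
    · intro i hi
      simp only [Finset.mem_filter, Finset.mem_univ, true_and] at hi
      refine ⟨π i, ?_, hπ i⟩
      simp only [Finset.mem_filter, Finset.mem_univ, true_and, hπ]
      exact lt_of_le_of_ne (not_lt.1 hi) (hfix i)
  have h2 := Finset.card_filter_add_card_filter_not (s := (Finset.univ : Finset (Fin m)))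
    (fun i => i < π i)
  rw [Finset.card_univ, Fintype.card_fin] at h2
  omega

section Orbits

variable {m : ℕ} {π : Equiv.Perm (Fin m)}

/-- For an involution `π`, the points `x + 1` and `π x` lie in the same cycle of `γ π`. -/
theorem mk_finRotate_eq_mk_apply (hπ : ∀ x, π (π x) = x) (x : Fin m) :
    (Quotient.mk (Equiv.Perm.SameCycle.setoid (finRotate m * π)) (finRotate m x)) =
      Quotient.mk _ (π x) := by
  refine Quotient.sound (Equiv.Perm.SameCycle.symm ⟨1, ?_⟩)
  simp [hπ]

theorem cycleCount_finRotate_mul_le (hpos : 0 < m) (S : Finset (Fin m))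
    (H : ∀ r : Fin m → Fin m → Prop, Equivalence r → (∀ x, r (finRotate m x) (π x)) →
      (∀ x ∈ S, r x (π x)) → ∀ x y, r x y) (hπ : ∀ x, π (π x) = x) :
    cycleCount (finRotate m * π) ≤ S.card + 1 := by
  rw [cycleCount_eq_card_quotient]
  have : Nonempty (Quotient (Equiv.Perm.SameCycle.setoid (finRotate m * π))) :=
    ⟨Quotient.mk _ ⟨0, hpos⟩⟩
  exact card_le_card_add_one_of_connecting (Quotient.mk _) Quotient.mk_surjective π S
    fun r hr hq hS => H r hr (fun x => hq _ _ (mk_finRotate_eq_mk_apply hπ x)) hS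

/-- If `S` meets the pair `{x, π x}`, then any relation as in `cycleCount_finRotate_mul_le`
relates `x` to `x + 1`. -/
theorem Equivalence.rel_finRotate_of_mem {r : Fin m → Fin m → Prop} (hr : Equivalence r)
    (hπ : ∀ x, π (π x) = x) (hrot : ∀ x, r (finRotate m x) (π x)) {S : Finset (Fin m)}
    (hS : ∀ x ∈ S, r x (π x)) {x : Fin m} (hx : x ∈ S ∨ π x ∈ S) : r x (finRotate m x) := by
  refine hr.trans ?_ (hr.symm (hrot x))
  rcases hx with h | h
  · exact hS x h
  · have := hS _ h
    rw [hπ] at this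
    exact hr.symm this

theorem cycleCount_finRotate_mul_le_half_add_one (hpos : 0 < m) (hπ : ∀ x, π (π x) = x)
    (hfix : ∀ i, π i ≠ i) : cycleCount (finRotate m * π) ≤ m / 2 + 1 := by
  rw [← card_filter_lt_apply π hπ hfix]
  refine cycleCount_finRotate_mul_le hpos _ (fun r hr hrot hS => ?_) hπ
  have h0 : ∀ x, r ⟨0, hpos⟩ x := fun x => by
    refine hr.rel_of_finRotate (Fin.le_def.2 (Nat.zero_le _)) fun y _ _ => ?_
    refine hr.rel_finRotate_of_mem hπ hrot hS ?_
    simp only [Finset.mem_filter, Finset.mem_univ, true_and, hπ]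
    exact lt_or_gt_of_ne (hfix y).symm
  exact fun x y => hr.trans (hr.symm (h0 x)) (h0 y)

theorem cycleCount_finRotate_mul_le_half_of_crossing (hπ : ∀ x, π (π x) = x)
    (hfix : ∀ i, π i ≠ i) {i j : Fin m} (hij : i < j) (hjk : j < π i) (hkl : π i < π j) :
    cycleCount (finRotate m * π) ≤ m / 2 := by
  have hpos : 0 < m := i.pos
  set O := Finset.univ.filter fun i => i < π i with hO
  have hi : i ∈ O := by simpa [hO] using hij.trans hjk
  have hcard : (O.erase i).card + 1 = m / 2 := by
    rw [Finset.card_erase_add_one hi, hO, card_filter_lt_apply π hπ hfix]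
  rw [← hcard]
  refine cycleCount_finRotate_mul_le hpos _ (fun r hr hrot hS => ?_) hπ
  have hstep : ∀ x, x ≠ i → x ≠ π i → r x (finRotate m x) := fun x hxi hxk => by
    refine hr.rel_finRotate_of_mem hπ hrot hS ?_
    have : π x ≠ i := fun h => hxk (by rw [← h, hπ])
    simp only [hO, Finset.mem_erase, Finset.mem_filter, Finset.mem_univ, true_and, hπ]
    rcases lt_or_gt_of_ne (hfix x).symm with h | h
    · exact .inl ⟨hxi, h⟩
    · exact .inr ⟨this, h⟩
  have hseg : ∀ {a b : Fin m}, a ≤ b → (∀ x, a ≤ x → x < b → x ≠ i ∧ x ≠ π i) → r a b :=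
    fun hab h => hr.rel_of_finRotate hab fun x hx hx' => hstep x (h x hx hx').1 (h x hx hx').2
  have hjl : r j (π j) := hS j <| by
    simp only [hO, Finset.mem_erase, Finset.mem_filter, Finset.mem_univ, true_and]
    exact ⟨hij.ne', hjk.trans hkl⟩
  have hmid : ∀ x, i < x → x ≤ π i → r j x := by
    intro x hx hx'
    rcases le_total j x with h | h
    · exact hseg h fun y hy hy' => ⟨by order, by order⟩
    · exact hr.symm (hseg h fun y hy hy' => ⟨by order, by order⟩)
  have hright : ∀ x, π i < x → r j x := by
    intro x hx
    refine hr.trans hjl ?_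
    rcases le_total (π j) x with h | h
    · exact hseg h fun y hy hy' => ⟨by order, by order⟩
    · exact hr.symm (hseg h fun y hy hy' => ⟨by order, by order⟩)
  have hleft : ∀ x, x ≤ i → r j x := by
    intro x hx
    let e : Fin m := ⟨m - 1, by omega⟩
    have hej : π j ≤ e := Fin.le_def.2 (by have := (π j).2; simp only [e]; omega)
    have he : finRotate m e = ⟨0, hpos⟩ := by
      ext
      rw [val_finRotate, if_pos (by simp only [e]; omega)]
    have h0 : r e ⟨0, hpos⟩ := by
      rw [← he]
      exact hstep e (by order) (by order)
    refine hr.trans (hr.trans (hright e (by order)) h0) ?_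
    exact hseg (Fin.le_def.2 (Nat.zero_le _)) fun y hy hy' => ⟨by order, by order⟩
  have hall : ∀ x, r j x := by
    intro x
    rcases le_or_gt x i with h | h
    · exact hleft x h
    · rcases le_or_gt x (π i) with h' | h'
      · exact hmid x h h'
      · exact hright x h'
  exact fun x y => hr.trans (hr.symm (hall x)) (hall y)

/-- For non-crossing `π`, the set of arcs above the gap preceding a point is constant on the
cycles of `γ π`. -/
theorem arcs_above_finRotate_mul (hπ : ∀ x, π (π x) = x)
    (hnc : ¬ ∃ i j k l : Fin m, i < j ∧ j < k ∧ k < l ∧ π i = k ∧ π j = l) (x i : Fin m) :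
    (i < (finRotate m * π) x ∧ (finRotate m * π) x ≤ π i) ↔ (i < x ∧ x ≤ π i) := by
  have hrot : (i < (finRotate m * π) x ∧ (finRotate m * π) x ≤ π i) ↔
      (i ≤ π x ∧ π x < π i) := by
    have := (π i).2
    have := (π x).2
    simp only [Equiv.Perm.mul_apply, Fin.lt_def, Fin.le_def, val_finRotate]
    split_ifs <;> omega
  rw [hrot]
  have hne : π x ≠ π i ↔ x ≠ i := π.injective.ne_iff
  have hne' : x = π i ↔ π x = i := ⟨fun h => by rw [h, hπ], fun h => by rw [← h, hπ]⟩
  by_cases h1 : x = i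
  · subst h1
    simp
  by_cases h2 : π x = i
  · have := hne'.2 h2
    subst this
    simp [hπ]
  constructor
  · rintro ⟨ha, hb⟩
    have ha : i < π x := lt_of_le_of_ne ha (Ne.symm h2)
    by_contra hcon
    rw [not_and_or, not_lt, not_le] at hcon
    rcases hcon with h | h
    · exact hnc ⟨x, i, π x, π i, lt_of_le_of_ne h h1, ha, hb, rfl, rfl⟩
    · exact hnc ⟨i, π x, π i, x, ha, hb, h, rfl, hπ x⟩
  · rintro ⟨ha, hb⟩
    have hb : x < π i := lt_of_le_of_ne hb (fun h => h2 (hne'.1 h))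
    by_contra hcon
    rw [not_and_or, not_le, not_lt] at hcon
    rcases hcon with h | h
    · exact hnc ⟨π x, i, x, π i, h, ha, hb, hπ x, rfl⟩
    · exact hnc ⟨i, x, π i, π x, ha, hb, lt_of_le_of_ne h (hne.2 h1).symm, rfl, rfl⟩

theorem half_add_one_le_cycleCount_of_noncrossing (hpos : 0 < m) (hπ : ∀ x, π (π x) = x)
    (hfix : ∀ i, π i ≠ i)
    (hnc : ¬ ∃ i j k l : Fin m, i < j ∧ j < k ∧ k < l ∧ π i = k ∧ π j = l) :
    m / 2 + 1 ≤ cycleCount (finRotate m * π) := by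
  have hinv : ∀ x y, (finRotate m * π).SameCycle x y →
      ∀ i, (i < x ∧ x ≤ π i) ↔ (i < y ∧ y ≤ π i) := by
    intro x y hxy i
    obtain ⟨n, -, -, rfl⟩ := hxy.exists_pow_eq
    induction n with
    | zero => rfl
    | succ n ih =>
      rw [pow_succ', Equiv.Perm.mul_apply, arcs_above_finRotate_mul hπ hnc]
      exact ih ⟨n, by simp⟩
  have hval : ∀ i : Fin m, i < π i → (finRotate m i : ℕ) = i + 1 := by
    intro i hi
    have := (π i).2
    rw [Fin.lt_def] at hi
    rw [val_finRotate, if_neg (by omega)]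
  rw [cycleCount_eq_card_quotient, ← card_filter_lt_apply π hπ hfix]
  let f : Option (Finset.univ.filter fun i => i < π i) →
      Quotient (Equiv.Perm.SameCycle.setoid (finRotate m * π)) := fun o =>
    o.elim (Quotient.mk _ ⟨0, hpos⟩) fun i => Quotient.mk _ (finRotate m i)
  have hmem : ∀ i : Fin m, i < π i → i < finRotate m i ∧ finRotate m i ≤ π i := by
    intro i hi
    simp only [Fin.lt_def, Fin.le_def, hval i hi] at hi ⊢
    omega
  have hf : Function.Injective f := by
    rintro (_ | ⟨i, hi⟩) (_ | ⟨j, hj⟩) h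
    · rfl
    · have h := (hinv _ _ (Quotient.exact h) j).2 (hmem j (by simpa using hj))
      exact absurd h.1 (by simp [Fin.lt_def])
    · have h := (hinv _ _ (Quotient.exact h) i).1 (hmem i (by simpa using hi))
      exact absurd h.1 (by simp [Fin.lt_def])
    · have hi : i < π i := by simpa using hi
      have hj : j < π j := by simpa using hj
      have h1 := ((hinv _ _ (Quotient.exact h) j).2 (hmem j hj)).1
      have h2 := ((hinv _ _ (Quotient.exact h) i).1 (hmem i hi)).1
      simp only [Fin.lt_def, hval i hi, hval j hj] at h1 h2
      have : i = j := Fin.ext (by omega)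
      subst this
      rfl
  have := Nat.card_le_card_of_injective f hf
  rwa [Finite.card_option, Nat.card_eq_fintype_card, Fintype.card_coe] at this

end Orbits

/-- If `π` is a pairing of `{1,...,m}` (`m` even and positive), regarded as a
fixed-point-free involution, and `γ = (1,2,...,m)` is the full cycle, then
`#cycles(γπ) = m/2 + 1` if and only if `π` is non-crossing. -/
theorem cycleCount_eq_iff_noncrossing (m : ℕ) (hm : Even m) (hpos : 0 < m)
    (π : Equiv.Perm (Fin m)) (hinv : π * π = 1) (hfix : ∀ i, π i ≠ i) :
    cycleCount (finRotate m * π) = m / 2 + 1 ↔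
      ¬ ∃ i j k l : Fin m, i < j ∧ j < k ∧ k < l ∧ π i = k ∧ π j = l := by
  have hπ : ∀ x, π (π x) = x := fun x => by
    rw [← Equiv.Perm.mul_apply, hinv, Equiv.Perm.one_apply]
  constructor
  · rintro h ⟨i, j, _, _, hij, hjk, hkl, rfl, rfl⟩
    have := cycleCount_finRotate_mul_le_half_of_crossing hπ hfix hij hjk hkl
    omega
  · exact fun h => le_antisymm (cycleCount_finRotate_mul_le_half_add_one hpos hπ hfix)
      (half_add_one_le_cycleCount_of_noncrossing hpos hπ hfix h)
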